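/- 𝓑(x) = 1 for every x ≤ 0, and 𝓑 is strictly decreasing on [0, +∞). -/

import Mathlib

open MeasureTheory

noncomputable section

/-- The dyadic subinterval `[k/2^n, (k+1)/2^n]` of `[0,1]`. -/
def dyadicI (n k : ℕ) : Set ℝ := Set.Icc ((k : ℝ) / 2 ^ n) (((k : ℝ) + 1) / 2 ^ n)

/-- The Haar function of the dyadic interval `[k/2^n, (k+1)/2^n]`: it equals `-1` on the
left half of the interval, `+1` on its right half and `0` elsewhere. -/
def haar (n k : ℕ) (x : ℝ) : ℝ :=
  if x ∈ Set.Ico ((k : ℝ) / 2 ^ n) ((2 * (k : ℝ) + 1) / 2 ^ (n + 1)) then -1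
  else if x ∈ Set.Ico ((2 * (k : ℝ) + 1) / 2 ^ (n + 1)) (((k : ℝ) + 1) / 2 ^ n) then 1
  else 0

/-- The Haar coefficient `a_J = μ(J)⁻¹ ∫_I f h_J` of `f` at `J = [k/2^n, (k+1)/2^n]`. -/
def haarCoeff (f : ℝ → ℝ) (n k : ℕ) : ℝ :=
  2 ^ n * ∫ x in Set.Icc (0 : ℝ) 1, f x * haar n k x

/-- The dyadic square function `Sf = √(Σ_J a_J² χ_J)`. -/
def sqFn (f : ℝ → ℝ) (x : ℝ) : ℝ :=
  Real.sqrt (∑' p : ℕ × ℕ, (haarCoeff f p.1 p.2) ^ 2 * (dyadicI p.1 p.2).indicator 1 x)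

/-- A test function for the Bellman function: integrable on `I = [0,1]`, with zero mean
and with dyadic square function essentially bounded by `1` on `I`. -/
def Admissible (f : ℝ → ℝ) : Prop :=
  IntegrableOn f (Set.Icc 0 1) ∧ (∫ x in Set.Icc (0 : ℝ) 1, f x) = 0 ∧
    ∀ᵐ x ∂(volume.restrict (Set.Icc (0 : ℝ) 1)), sqFn f x ≤ 1

/-- The Bellman function `𝓑(x) = sup{ μ{f ≥ x} : ∫_I f = 0, ‖Sf‖_∞ ≤ 1 }`. -/
def bellman (x : ℝ) : ℝ :=
  sSup { m : ℝ | ∃ f : ℝ → ℝ, Admissible f ∧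
    m = (volume { y ∈ Set.Icc (0 : ℝ) 1 | x ≤ f y }).toReal }

open Filter Topology

/-- Lebesgue measure on `[0,1]`. -/
def unitMeas : Measure ℝ := volume.restrict (Set.Icc (0 : ℝ) 1)

instance : IsProbabilityMeasure unitMeas := ⟨by simp [unitMeas]⟩

/-- The index of the dyadic interval of generation `n` containing `x`. -/
def lvl (n : ℕ) (x : ℝ) : ℕ := ⌊2 ^ n * x⌋₊

/-- The `n`-th Rademacher function. -/
def rad (n : ℕ) (x : ℝ) : ℝ := if Odd (lvl (n + 1) x) then 1 else -1

/-- The indicator of the `k`-th dyadic interval of generation `n`. -/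
def cell (n k : ℕ) (x : ℝ) : ℝ := if lvl n x = k then 1 else 0

/-- `G` is constant on the dyadic intervals of generation `n`. -/
def AdaptedTo (n : ℕ) (G : ℝ → ℝ) : Prop := ∀ x y, lvl n x = lvl n y → G x = G y

lemma lvl_succ_div_two (n : ℕ) (x : ℝ) : lvl (n + 1) x / 2 = lvl n x := by
  unfold lvl
  rw [← Nat.floor_div_natCast]
  congr 1
  push_cast
  ring

lemma lvl_add_div (n m : ℕ) (x : ℝ) : lvl (n + m) x / 2 ^ m = lvl n x := by
  unfold lvl
  rw [← Nat.floor_div_natCast]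
  congr 1
  push_cast
  field_simp
  ring

lemma lvl_eq_of_le {m n : ℕ} (h : m ≤ n) {x y : ℝ} (hxy : lvl n x = lvl n y) :
    lvl m x = lvl m y := by
  obtain ⟨d, rfl⟩ := Nat.exists_eq_add_of_le h
  rw [← lvl_add_div m d x, ← lvl_add_div m d y, hxy]

lemma lvl_left_endpoint (n k : ℕ) : lvl n ((k : ℝ) / 2 ^ n) = k := by
  unfold lvl
  rw [mul_div_cancel₀ _ (by positivity)]
  simp

lemma lvl_eq_iff (n k : ℕ) {x : ℝ} (hx : 0 ≤ x) :
    lvl n x = k ↔ x ∈ Set.Ico ((k : ℝ) / 2 ^ n) (((k : ℝ) + 1) / 2 ^ n) := by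
  unfold lvl
  rw [Nat.floor_eq_iff (by positivity), Set.mem_Ico, div_le_iff₀ (by positivity),
    lt_div_iff₀ (by positivity), mul_comm]

lemma lvl_lt (n : ℕ) {x : ℝ} (hx : x < 1) : lvl n x < 2 ^ n := by
  unfold lvl
  refine (Nat.floor_lt' (by positivity)).2 ?_
  push_cast
  nlinarith [show (0 : ℝ) < 2 ^ n by positivity]

lemma lvl_le (n : ℕ) {x : ℝ} (hx : x ≤ 1) : lvl n x ≤ 2 ^ n := by
  unfold lvl
  refine Nat.floor_le_of_le ?_
  push_cast
  nlinarith [show (0 : ℝ) < 2 ^ n by positivity]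

lemma measurable_lvl (n : ℕ) : Measurable (lvl n) := by
  unfold lvl
  fun_prop

lemma rad_sq (n : ℕ) (x : ℝ) : rad n x * rad n x = 1 := by
  unfold rad; split_ifs <;> norm_num

lemma abs_rad (n : ℕ) (x : ℝ) : |rad n x| = 1 := by
  unfold rad; split_ifs <;> norm_num

namespace AdaptedTo

variable {n m : ℕ} {F G : ℝ → ℝ}

lemma mono (hG : AdaptedTo m G) (h : m ≤ n) : AdaptedTo n G :=
  fun x y hxy => hG x y (lvl_eq_of_le h hxy)

lemma comp_lvl (n : ℕ) (φ : ℕ → ℝ) : AdaptedTo n (fun x => φ (lvl n x)) :=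
  fun _ _ h => congrArg φ h

lemma exists_eq (hG : AdaptedTo n G) : ∃ φ : ℕ → ℝ, G = fun x => φ (lvl n x) :=
  ⟨fun k => G ((k : ℝ) / 2 ^ n), funext fun _ => hG _ _ (lvl_left_endpoint n _).symm⟩

lemma mul (hF : AdaptedTo n F) (hG : AdaptedTo n G) : AdaptedTo n (fun x => F x * G x) :=
  fun x y h => congrArg₂ (· * ·) (hF x y h) (hG x y h)

lemma add (hF : AdaptedTo n F) (hG : AdaptedTo n G) : AdaptedTo n (fun x => F x + G x) :=
  fun x y h => congrArg₂ (· + ·) (hF x y h) (hG x y h)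

lemma comp (hG : AdaptedTo n G) (φ : ℝ → ℝ) : AdaptedTo n (fun x => φ (G x)) :=
  fun x y h => congrArg φ (hG x y h)

lemma sum {ι : Type*} {s : Finset ι} {H : ι → ℝ → ℝ} (h : ∀ i ∈ s, AdaptedTo n (H i)) :
    AdaptedTo n (fun x => ∑ i ∈ s, H i x) :=
  fun x y hxy => Finset.sum_congr rfl fun i hi => h i hi x y hxy

lemma measurable (hG : AdaptedTo n G) : Measurable G := by
  obtain ⟨φ, rfl⟩ := hG.exists_eq
  exact (measurable_of_countable φ).comp (measurable_lvl n)

lemma integrable (hG : AdaptedTo n G) : Integrable G unitMeas := by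
  have hm := hG.measurable
  obtain ⟨φ, rfl⟩ := hG.exists_eq
  refine Integrable.of_bound hm.aestronglyMeasurable
    (∑ k ∈ Finset.range (2 ^ n + 1), |φ k|) ?_
  filter_upwards [ae_restrict_mem measurableSet_Icc] with x hx
  exact Finset.single_le_sum (f := fun k => |φ k|) (fun _ _ => abs_nonneg _)
    (Finset.mem_range.2 (Nat.lt_succ_of_le (lvl_le n hx.2)))

end AdaptedTo

lemma adaptedTo_rad (n : ℕ) : AdaptedTo (n + 1) (rad n) :=
  fun _ _ h => by simp only [rad, h]

lemma adaptedTo_cell (n k : ℕ) : AdaptedTo n (cell n k) :=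
  fun _ _ h => by simp only [cell, h]

lemma ae_mem_Ico : ∀ᵐ x ∂unitMeas, x ∈ Set.Ico (0 : ℝ) 1 := by
  have h1 : ∀ᵐ x ∂unitMeas, x ≠ 1 := by
    refine ae_restrict_of_ae ?_
    simp [ae_iff]
  filter_upwards [ae_restrict_mem measurableSet_Icc, h1] with x hx h1
  exact ⟨hx.1, lt_of_le_of_ne hx.2 h1⟩

lemma cell_succ_odd (n k : ℕ) (x : ℝ) :
    cell (n + 1) (2 * k + 1) x = cell n k x * (1 + rad n x) / 2 := by
  have h := lvl_succ_div_two n x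
  unfold cell rad
  by_cases h1 : lvl n x = k <;> by_cases h2 : Odd (lvl (n + 1) x)
  · rw [if_pos h1, if_pos h2, if_pos (by obtain ⟨j, hj⟩ := h2; omega)]; norm_num
  · rw [if_pos h1, if_neg h2, if_neg (by rw [Nat.odd_iff] at h2; omega)]; norm_num
  · rw [if_neg h1, if_neg (by omega)]; norm_num
  · rw [if_neg h1, if_neg (by omega)]; norm_num

lemma cell_succ_even (n k : ℕ) (x : ℝ) :
    cell (n + 1) (2 * k) x = cell n k x * (1 - rad n x) / 2 := by
  have h := lvl_succ_div_two n x
  unfold cell rad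
  by_cases h1 : lvl n x = k <;> by_cases h2 : Odd (lvl (n + 1) x)
  · rw [if_pos h1, if_pos h2, if_neg (by rw [Nat.odd_iff] at h2; omega)]; norm_num
  · rw [if_pos h1, if_neg h2, if_pos (by rw [Nat.odd_iff] at h2; omega)]; norm_num
  · rw [if_neg h1, if_neg (by omega)]; norm_num
  · rw [if_neg h1, if_neg (by omega)]; norm_num

lemma haar_eq (n k : ℕ) {x : ℝ} (hx : 0 ≤ x) : haar n k x = cell n k x * rad n x := by
  have h1 := lvl_eq_iff (n + 1) (2 * k) hx
  have h2 := lvl_eq_iff (n + 1) (2 * k + 1) hx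
  have h3 := cell_succ_odd n k x
  have h4 := cell_succ_even n k x
  have e1 : ((2 * k : ℕ) : ℝ) / 2 ^ (n + 1) = k / 2 ^ n := by
    push_cast; rw [pow_succ]; field_simp
  have e2 : (((2 * k + 1 : ℕ) : ℝ) + 1) / 2 ^ (n + 1) = (k + 1) / 2 ^ n := by
    push_cast; rw [pow_succ]; field_simp; ring
  rw [e1] at h1
  rw [e2] at h2
  push_cast at h1 h2
  have h5 : cell n k x * rad n x = cell (n + 1) (2 * k + 1) x - cell (n + 1) (2 * k) x := by
    rw [h3, h4]; ring
  rw [h5]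
  unfold haar cell
  simp only [← h1, ← h2]
  split_ifs <;> first | omega | norm_num

lemma integral_cell (n : ℕ) {k : ℕ} (hk : k < 2 ^ n) : ∫ x, cell n k x ∂unitMeas = 1 / 2 ^ n := by
  have h1 : ∀ᵐ x ∂unitMeas, cell n k x =
      (Set.Ico ((k : ℝ) / 2 ^ n) (((k : ℝ) + 1) / 2 ^ n)).indicator 1 x := by
    filter_upwards [ae_mem_Ico] with x hx
    simp only [cell, Set.indicator, lvl_eq_iff n k hx.1, Pi.one_apply]
  rw [integral_congr_ae h1, integral_indicator_one measurableSet_Ico]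
  have hk' : ((k : ℝ) + 1) ≤ 2 ^ n := by exact_mod_cast hk
  have hsub : Set.Ico ((k : ℝ) / 2 ^ n) (((k : ℝ) + 1) / 2 ^ n) ⊆ Set.Icc 0 1 := by
    intro x hx
    exact ⟨le_trans (by positivity) hx.1, hx.2.le.trans ((div_le_one (by positivity)).2 hk')⟩
  rw [unitMeas, measureReal_restrict_apply measurableSet_Ico, Set.inter_eq_left.2 hsub,
    Real.volume_real_Ico_of_le (by gcongr; linarith)]
  ring

lemma AdaptedTo.integral_mul_rad {n : ℕ} {G : ℝ → ℝ} (hG : AdaptedTo n G) :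
    ∫ x, G x * rad n x ∂unitMeas = 0 := by
  obtain ⟨φ, rfl⟩ := hG.exists_eq
  have h1 : ∀ᵐ x ∂unitMeas, φ (lvl n x) * rad n x = ∑ k ∈ Finset.range (2 ^ n),
      (φ k * (2 * cell (n + 1) (2 * k + 1) x - cell n k x)) := by
    filter_upwards [ae_mem_Ico] with x hx
    rw [Finset.sum_eq_single_of_mem (lvl n x) (Finset.mem_range.2 (lvl_lt n hx.2))]
    · rw [cell_succ_odd]; simp only [cell, if_true]; ring
    · intro k _ hk
      rw [cell_succ_odd]; simp only [cell, if_neg hk.symm]; ring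
  rw [integral_congr_ae h1, integral_finsetSum]
  · refine Finset.sum_eq_zero fun k hk => ?_
    have hk := Finset.mem_range.1 hk
    rw [integral_const_mul, integral_sub ((adaptedTo_cell _ _).integrable.const_mul 2)
      (adaptedTo_cell _ _).integrable, integral_const_mul, integral_cell n hk,
      integral_cell (n + 1) (by rw [pow_succ]; omega), pow_succ]
    field_simp
    simp
  · intro k _
    exact (((adaptedTo_cell _ _).integrable.const_mul 2).sub
      (adaptedTo_cell _ _).integrable).const_mul _

/-- The martingale transform with predictable increments `b`. -/
def radSum (b : ℕ → ℝ → ℝ) (n : ℕ) (x : ℝ) : ℝ := ∑ m ∈ Finset.range n, b m x * rad m x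

lemma adaptedTo_radSum {b : ℕ → ℝ → ℝ} (hb : ∀ m, AdaptedTo m (b m)) (n : ℕ) :
    AdaptedTo n (radSum b n) :=
  AdaptedTo.sum fun m hm => (((hb m).mono m.le_succ).mul (adaptedTo_rad m)).mono
    (Finset.mem_range.1 hm)

lemma integral_radSum {b : ℕ → ℝ → ℝ} (hb : ∀ m, AdaptedTo m (b m)) (n : ℕ) :
    ∫ x, radSum b n x ∂unitMeas = 0 := by
  unfold radSum
  rw [integral_finsetSum]
  · exact Finset.sum_eq_zero fun m _ => (hb m).integral_mul_rad
  · exact fun m _ => (((hb m).mono m.le_succ).mul (adaptedTo_rad m)).integrable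

lemma integral_radSum_sq {b : ℕ → ℝ → ℝ} (hb : ∀ m, AdaptedTo m (b m)) (n : ℕ) :
    ∫ x, radSum b n x ^ 2 ∂unitMeas = ∫ x, ∑ m ∈ Finset.range n, b m x ^ 2 ∂unitMeas := by
  induction n with
  | zero => simp [radSum]
  | succ n ih =>
    have hW := adaptedTo_radSum hb n
    have e1 : ∀ x, radSum b (n + 1) x ^ 2 =
        (radSum b n x ^ 2 + b n x ^ 2) + (2 * radSum b n x * b n x) * rad n x := by
      intro x
      have := rad_sq n x
      rw [radSum, Finset.sum_range_succ, ← radSum]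
      linear_combination (b n x) ^ 2 * this
    have hX : AdaptedTo n (fun x => 2 * radSum b n x * b n x) := (hW.comp (2 * ·)).mul (hb n)
    have hs : AdaptedTo n (fun x => ∑ m ∈ Finset.range n, b m x ^ 2) :=
      AdaptedTo.sum fun m hm => ((hb m).comp (· ^ 2)).mono (Finset.mem_range.1 hm).le
    simp_rw [e1, Finset.sum_range_succ]
    rw [integral_add, integral_add, integral_add, ih, hX.integral_mul_rad, add_zero]
    · exact hs.integrable
    · exact ((hb n).comp (· ^ 2)).integrable
    · exact (hW.comp (· ^ 2)).integrable
    · exact ((hb n).comp (· ^ 2)).integrable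
    · exact ((hW.comp (· ^ 2)).add ((hb n).comp (· ^ 2))).integrable
    · exact ((hX.mono n.le_succ).mul (adaptedTo_rad n)).integrable

/-- The Haar coefficient of `f` at the dyadic interval of generation `n` containing `x`. -/
def coeffAt (f : ℝ → ℝ) (n : ℕ) (x : ℝ) : ℝ := haarCoeff f n (lvl n x)

/-- The dyadic martingale of `f`. -/
def mart (f : ℝ → ℝ) (n : ℕ) (x : ℝ) : ℝ := 2 ^ n * ∫ t, f t * cell n (lvl n x) t ∂unitMeas

lemma adaptedTo_coeffAt (f : ℝ → ℝ) (n : ℕ) : AdaptedTo n (coeffAt f n) :=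
  AdaptedTo.comp_lvl n (haarCoeff f n)

lemma adaptedTo_mart (f : ℝ → ℝ) (n : ℕ) : AdaptedTo n (mart f n) :=
  AdaptedTo.comp_lvl n fun k => 2 ^ n * ∫ t, f t * cell n k t ∂unitMeas

lemma haarCoeff_eq (f : ℝ → ℝ) (n k : ℕ) :
    haarCoeff f n k = 2 ^ n * ∫ t, f t * (cell n k t * rad n t) ∂unitMeas := by
  rw [haarCoeff, ← unitMeas]
  congr 1
  refine integral_congr_ae ?_
  filter_upwards [ae_mem_Ico] with x hx
  rw [haar_eq n k hx.1]

lemma coeffAt_radSum {b : ℕ → ℝ → ℝ} (hb : ∀ m, AdaptedTo m (b m)) (L n : ℕ) {x : ℝ}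
    (hx : x ∈ Set.Ico (0 : ℝ) 1) :
    coeffAt (radSum b L) n x = if n < L then b n x else 0 := by
  set k := lvl n x with hk
  have hterm : ∀ m, ∫ t, b m t * rad m t * (cell n k t * rad n t) ∂unitMeas =
      if n = m then b n x * (1 / 2 ^ n) else 0 := by
    intro m
    rcases lt_trichotomy n m with h | h | h
    · rw [if_neg h.ne]
      have hA : AdaptedTo m (fun t => b m t * (cell n k t * rad n t)) :=
        (hb m).mul (((adaptedTo_cell n k).mono h.le).mul ((adaptedTo_rad n).mono h))
      rw [← hA.integral_mul_rad]
      congr 1; ext t; ring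
    · subst h
      rw [if_pos rfl, ← integral_cell n (lvl_lt n hx.2), ← integral_const_mul]
      congr 1; ext t
      have hr := rad_sq n t
      by_cases h : lvl n t = k
      · rw [hb n t x h, ← hk]
        linear_combination b n x * cell n k t * hr
      · have hc : cell n k t = 0 := if_neg h
        rw [hc]
        ring
    · rw [if_neg h.ne']
      have hA : AdaptedTo n (fun t => b m t * rad m t * cell n k t) :=
        (((hb m).mono h.le).mul ((adaptedTo_rad m).mono h)).mul (adaptedTo_cell n k)
      rw [← hA.integral_mul_rad]
      congr 1; ext t; ring
  rw [coeffAt, haarCoeff_eq, ← hk]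
  simp only [radSum, Finset.sum_mul]
  rw [integral_finsetSum]
  · simp only [hterm, Finset.sum_ite_eq, Finset.mem_range]
    split_ifs
    · field_simp
    · simp
  · intro m _
    have h1 := ((hb m).mono (m.le_succ.trans (le_max_left _ (n + 1))))
    have h2 := (adaptedTo_rad m).mono (le_max_left _ (n + 1))
    have h3 := ((adaptedTo_cell n k).mono n.le_succ).mono (le_max_right (m + 1) _)
    have h4 := (adaptedTo_rad n).mono (le_max_right (m + 1) _)
    exact ((h1.mul h2).mul (h3.mul h4)).integrable

lemma ae_sqFn_eq (f : ℝ → ℝ) :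
    ∀ᵐ x ∂unitMeas, sqFn f x = √(∑' n, coeffAt f n x ^ 2) := by
  have hc : (Set.range fun p : ℕ × ℕ => (p.1 : ℝ) / 2 ^ p.2).Countable := Set.countable_range _
  have hd : ∀ᵐ x ∂unitMeas, x ∉ Set.range fun p : ℕ × ℕ => (p.1 : ℝ) / 2 ^ p.2 :=
    ae_restrict_of_ae (hc.ae_notMem volume)
  filter_upwards [ae_mem_Ico, hd] with x hx hxd
  have key : ∀ n k, x ∈ dyadicI n k ↔ lvl n x = k := by
    intro n k
    rw [lvl_eq_iff n k hx.1, dyadicI]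
    refine ⟨fun h => ⟨h.1, lt_of_le_of_ne h.2 fun h' => hxd ⟨(k + 1, n), ?_⟩⟩,
      fun h => Set.Ico_subset_Icc_self h⟩
    rw [h']; push_cast; rfl
  have hinj : Function.Injective fun n => (n, lvl n x) := fun a b h => (Prod.ext_iff.1 h).1
  rw [sqFn, ← hinj.tsum_eq]
  · congr 2
    ext n
    simp [coeffAt, Set.indicator, key]
  · rintro ⟨n, k⟩ h
    refine ⟨n, ?_⟩
    by_contra h'
    refine h ?_
    have : x ∉ dyadicI n k := fun h2 => h' (Prod.ext rfl ((key n k).1 h2))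
    simp [this]

lemma admissible_radSum {b : ℕ → ℝ → ℝ} (hb : ∀ m, AdaptedTo m (b m)) (L : ℕ)
    (h : ∀ x ∈ Set.Ico (0 : ℝ) 1, ∑ m ∈ Finset.range L, b m x ^ 2 ≤ 1) : Admissible (radSum b L) := by
  refine ⟨(adaptedTo_radSum hb L).integrable, integral_radSum hb L, ?_⟩
  filter_upwards [ae_sqFn_eq (radSum b L), ae_mem_Ico] with x hx hx'
  rw [hx]
  refine Real.sqrt_le_one.2 (le_trans (le_of_eq ?_) (h x hx'))
  rw [tsum_eq_sum (s := Finset.range L)]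
  · refine Finset.sum_congr rfl fun m hm => ?_
    rw [coeffAt_radSum hb L m hx', if_pos (Finset.mem_range.1 hm)]
  · intro m hm
    rw [coeffAt_radSum hb L m hx', if_neg (by simpa using hm)]
    simp

lemma cell_measurable (n k : ℕ) : Measurable (cell n k) := (adaptedTo_cell n k).measurable

lemma integrable_mul_cell {f : ℝ → ℝ} (hf : Integrable f unitMeas) (n k : ℕ) :
    Integrable (fun t => f t * cell n k t) unitMeas := by
  refine hf.mul_bdd (c := 1) (cell_measurable n k).aestronglyMeasurable (ae_of_all _ fun t => ?_)
  unfold cell; split_ifs <;> simp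

lemma integrable_mul_cell_rad {f : ℝ → ℝ} (hf : Integrable f unitMeas) (n k : ℕ) :
    Integrable (fun t => f t * (cell n k t * rad n t)) unitMeas := by
  refine ((integrable_mul_cell hf (n + 1) (2 * k + 1)).sub
    (integrable_mul_cell hf (n + 1) (2 * k))).congr (ae_of_all _ fun t => ?_)
  simp only [Pi.sub_apply, cell_succ_odd, cell_succ_even]
  ring

lemma mart_succ {f : ℝ → ℝ} (hf : Integrable f unitMeas) (n : ℕ) (x : ℝ) :
    mart f (n + 1) x = mart f n x + coeffAt f n x * rad n x := by
  have h := lvl_succ_div_two n x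
  have hi := integrable_mul_cell hf n (lvl n x)
  have hj := integrable_mul_cell_rad hf n (lvl n x)
  rw [coeffAt, haarCoeff_eq, mart, mart]
  by_cases ho : Odd (lvl (n + 1) x)
  · have e : lvl (n + 1) x = 2 * lvl n x + 1 := by obtain ⟨j, hj⟩ := ho; omega
    have hr : rad n x = 1 := if_pos ho
    have e2 : ∀ t, f t * cell (n + 1) (2 * lvl n x + 1) t =
        1 / 2 * (f t * cell n (lvl n x) t + f t * (cell n (lvl n x) t * rad n t)) := by
      intro t; rw [cell_succ_odd]; ring
    rw [e, hr]
    simp_rw [e2]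
    rw [integral_const_mul, integral_add hi hj]
    ring
  · have e : lvl (n + 1) x = 2 * lvl n x := by rw [Nat.odd_iff] at ho; omega
    have hr : rad n x = -1 := if_neg ho
    have e2 : ∀ t, f t * cell (n + 1) (2 * lvl n x) t =
        1 / 2 * (f t * cell n (lvl n x) t - f t * (cell n (lvl n x) t * rad n t)) := by
      intro t; rw [cell_succ_even]; ring
    rw [e, hr]
    simp_rw [e2]
    rw [integral_const_mul, integral_sub hi hj]
    ring

lemma mart_zero {f : ℝ → ℝ} (h0 : ∫ x, f x ∂unitMeas = 0) {x : ℝ}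
    (hx : x ∈ Set.Ico (0 : ℝ) 1) : mart f 0 x = 0 := by
  have hl : ∀ y ∈ Set.Ico (0 : ℝ) 1, lvl 0 y = 0 := fun y hy => by
    have := lvl_lt 0 hy.2
    omega
  rw [mart, hl x hx, pow_zero, one_mul, ← h0]
  refine integral_congr_ae ?_
  filter_upwards [ae_mem_Ico] with t ht
  simp [cell, hl t ht]

lemma radSum_coeffAt {f : ℝ → ℝ} (hf : Integrable f unitMeas) (h0 : ∫ x, f x ∂unitMeas = 0)
    (n : ℕ) {x : ℝ} (hx : x ∈ Set.Ico (0 : ℝ) 1) : radSum (coeffAt f) n x = mart f n x := by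
  induction n with
  | zero => rw [mart_zero h0 hx]; simp [radSum]
  | succ n ih => rw [mart_succ hf, ← ih, radSum, Finset.sum_range_succ, ← radSum]

lemma ae_tendsto_mart {f : ℝ → ℝ} (hf : Integrable f unitMeas) :
    ∀ᵐ x ∂unitMeas, Tendsto (fun n => mart f n x) atTop (𝓝 (f x)) := by
  set g : ℝ → ℝ := (Set.Icc (0 : ℝ) 1).indicator f with hg
  have hgi : Integrable g volume := (integrable_indicator_iff measurableSet_Icc).2 hf
  have h1 := IsUnifLocDoublingMeasure.ae_tendsto_average volume hgi.locallyIntegrable 1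
  filter_upwards [ae_mem_Ico, ae_restrict_of_ae h1] with x hx hx1
  have hfx : g x = f x := Set.indicator_of_mem (Set.Ico_subset_Icc_self hx) f
  rw [← hfx]
  have hball : ∀ n : ℕ, Metric.closedBall (((lvl n x : ℝ) + 1 / 2) / 2 ^ n) (1 / 2 / 2 ^ n) =
      Set.Icc ((lvl n x : ℝ) / 2 ^ n) (((lvl n x : ℝ) + 1) / 2 ^ n) := by
    intro n
    rw [Real.closedBall_eq_Icc]
    congr 1 <;> ring
  have hxm : ∀ n : ℕ, x ∈ Set.Ico ((lvl n x : ℝ) / 2 ^ n) (((lvl n x : ℝ) + 1) / 2 ^ n) :=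
    fun n => (lvl_eq_iff n _ hx.1).1 rfl
  have h2 := hx1 (l := atTop) (fun n : ℕ => ((lvl n x : ℝ) + 1 / 2) / 2 ^ n)
    (fun n : ℕ => 1 / 2 / 2 ^ n) ?_ ?_
  · refine h2.congr fun n => ?_
    rw [hball, setAverage_eq, Real.volume_real_Icc_of_le (by gcongr; linarith), mart, smul_eq_mul]
    congr 1
    · field_simp; ring
    · rw [integral_Icc_eq_integral_Ico, setIntegral_indicator measurableSet_Icc, Set.inter_comm,
        ← setIntegral_indicator measurableSet_Ico, ← unitMeas]
      refine integral_congr_ae ?_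
      filter_upwards [ae_mem_Ico] with t ht
      simp only [cell, Set.indicator, lvl_eq_iff n _ ht.1, mul_ite, mul_one, mul_zero]
      split_ifs <;> rfl
  · refine tendsto_nhdsWithin_iff.2 ⟨?_, Eventually.of_forall fun n => ?_⟩
    · have := (tendsto_pow_atTop_nhds_zero_of_lt_one (r := (1 / 2 : ℝ)) (by norm_num)
        (by norm_num)).const_mul (1 / 2 : ℝ)
      rw [mul_zero] at this
      refine this.congr fun n => ?_
      rw [one_div_pow]; ring
    · exact Set.mem_Ioi.2 (by positivity)
  · refine Eventually.of_forall fun n => ?_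
    rw [one_mul, hball]
    exact Set.Ico_subset_Icc_self (hxm n)

lemma summable_of_integral_sum_le {b : ℕ → ℝ → ℝ} (hb : ∀ m, AdaptedTo m (b m)) {C : ℝ}
    (h : ∀ n, ∫ x, ∑ m ∈ Finset.range n, b m x ^ 2 ∂unitMeas ≤ C) :
    ∀ᵐ x ∂unitMeas, Summable fun m => b m x ^ 2 := by
  have hsq : ∀ m, AdaptedTo m (fun x => b m x ^ 2) := fun m => (hb m).comp (· ^ 2)
  have hmeas : ∀ m, Measurable fun x => ENNReal.ofReal (b m x ^ 2) :=
    fun m => (hsq m).measurable.ennreal_ofReal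
  have hlt : ∫⁻ x, ∑' m, ENNReal.ofReal (b m x ^ 2) ∂unitMeas ≠ ⊤ := by
    refine ne_top_of_le_ne_top (ENNReal.ofReal_ne_top (r := C)) ?_
    rw [lintegral_tsum fun m => (hmeas m).aemeasurable]
    refine ENNReal.tsum_le_of_sum_range_le fun n => ?_
    rw [← lintegral_finsetSum _ fun m _ => hmeas m]
    refine le_trans (le_of_eq ?_) (ENNReal.ofReal_le_ofReal (h n))
    rw [ofReal_integral_eq_lintegral_ofReal]
    · congr 1; ext x
      rw [ENNReal.ofReal_sum_of_nonneg fun m _ => sq_nonneg _]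
    · exact integrable_finsetSum _ fun m _ => (hsq m).integrable
    · exact ae_of_all _ fun x => Finset.sum_nonneg fun m _ => sq_nonneg _
  filter_upwards [ae_lt_top (Measurable.tsum hmeas) hlt] with x hx
  refine (ENNReal.summable_toReal hx.ne).congr fun m => ?_
  rw [ENNReal.toReal_ofReal (sq_nonneg _)]

/-- The increments of the dyadic martingale of `f`, stopped before it leaves `[-K, K]`. -/
def stoppedCoeff (f : ℝ → ℝ) (K : ℝ) (n : ℕ) (x : ℝ) : ℝ :=
  open Classical in
  if ∀ j ≤ n, |mart f j x| + |coeffAt f j x| ≤ K then coeffAt f n x else 0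

lemma adaptedTo_stoppedCoeff (f : ℝ → ℝ) (K : ℝ) (n : ℕ) :
    AdaptedTo n (stoppedCoeff f K n) := by
  intro x y h
  have h1 : ∀ j ≤ n, mart f j x = mart f j y := fun j hj => (adaptedTo_mart f j).mono hj x y h
  have h2 : ∀ j ≤ n, coeffAt f j x = coeffAt f j y :=
    fun j hj => (adaptedTo_coeffAt f j).mono hj x y h
  have h3 : (∀ j ≤ n, |mart f j x| + |coeffAt f j x| ≤ K) ↔
      ∀ j ≤ n, |mart f j y| + |coeffAt f j y| ≤ K :=
    forall₂_congr fun j hj => by rw [h1 j hj, h2 j hj]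
  simp only [stoppedCoeff, h3, h2 n le_rfl]

lemma abs_radSum_stoppedCoeff_le {f : ℝ → ℝ} (hf : Integrable f unitMeas)
    (h0 : ∫ x, f x ∂unitMeas = 0) {K : ℝ} (hK : 0 ≤ K) (n : ℕ) {x : ℝ}
    (hx : x ∈ Set.Ico (0 : ℝ) 1) : |radSum (stoppedCoeff f K) n x| ≤ K := by
  suffices H : ((∀ j < n, |mart f j x| + |coeffAt f j x| ≤ K) →
      radSum (stoppedCoeff f K) n x = mart f n x) ∧ |radSum (stoppedCoeff f K) n x| ≤ K from H.2
  induction n with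
  | zero => rw [mart_zero h0 hx]; simpa [radSum] using hK
  | succ n ih =>
    have e : radSum (stoppedCoeff f K) (n + 1) x =
        radSum (stoppedCoeff f K) n x + stoppedCoeff f K n x * rad n x := by
      rw [radSum, Finset.sum_range_succ, ← radSum]
    by_cases hv : ∀ j ≤ n, |mart f j x| + |coeffAt f j x| ≤ K
    · have e2 : radSum (stoppedCoeff f K) (n + 1) x = mart f (n + 1) x := by
        rw [e, ih.1 fun j hj => hv j hj.le, stoppedCoeff, if_pos hv, mart_succ hf]
      refine ⟨fun _ => e2, ?_⟩
      rw [e2, mart_succ hf]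
      refine (abs_add_le _ _).trans ?_
      rw [abs_mul, abs_rad, mul_one]
      exact hv n le_rfl
    · have e2 : radSum (stoppedCoeff f K) (n + 1) x = radSum (stoppedCoeff f K) n x := by
        rw [e, stoppedCoeff, if_neg hv, zero_mul, add_zero]
      exact ⟨fun h => absurd (fun j hj => h j (Nat.lt_succ_of_le hj)) hv, e2 ▸ ih.2⟩

lemma ae_summable_coeffAt_sq {f : ℝ → ℝ} (hf : Integrable f unitMeas)
    (h0 : ∫ x, f x ∂unitMeas = 0) : ∀ᵐ x ∂unitMeas, Summable fun n => coeffAt f n x ^ 2 := by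
  have h1 : ∀ᵐ x ∂unitMeas, ∀ K : ℕ, Summable fun n => stoppedCoeff f K n x ^ 2 := by
    refine ae_all_iff.2 fun K => summable_of_integral_sum_le (C := (K : ℝ) ^ 2)
      (adaptedTo_stoppedCoeff f K) fun n => ?_
    rw [← integral_radSum_sq (adaptedTo_stoppedCoeff f K)]
    calc ∫ x, radSum (stoppedCoeff f K) n x ^ 2 ∂unitMeas
        ≤ ∫ _, (K : ℝ) ^ 2 ∂unitMeas := by
          refine integral_mono_ae
            (((adaptedTo_radSum (adaptedTo_stoppedCoeff f K) n).comp (· ^ 2)).integrable)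
            (integrable_const _) ?_
          filter_upwards [ae_mem_Ico] with x hx
          exact sq_le_sq' (abs_le.1 (abs_radSum_stoppedCoeff_le hf h0 K.cast_nonneg n hx)).1
            (abs_le.1 (abs_radSum_stoppedCoeff_le hf h0 K.cast_nonneg n hx)).2
      _ = (K : ℝ) ^ 2 := by simp
  filter_upwards [h1, ae_tendsto_mart hf] with x hx hlim
  obtain ⟨C, hC⟩ := hlim.abs.bddAbove_range
  have hC' : ∀ n, |mart f n x| ≤ C := fun n => hC ⟨n, rfl⟩
  obtain ⟨K, hK⟩ := exists_nat_ge (3 * C)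
  refine (hx K).congr fun n => ?_
  rw [stoppedCoeff, if_pos]
  intro j _
  have e : coeffAt f j x * rad j x = mart f (j + 1) x - mart f j x := by
    rw [mart_succ hf]; ring
  have e2 : |coeffAt f j x| = |mart f (j + 1) x - mart f j x| := by
    rw [← e, abs_mul, abs_rad, mul_one]
  have := abs_sub (mart f (j + 1) x) (mart f j x)
  linarith [hC' j, hC' (j + 1)]

lemma Admissible.integrable {f : ℝ → ℝ} (hf : Admissible f) : Integrable f unitMeas := hf.1

lemma Admissible.ae_sum_coeffAt_sq_le {f : ℝ → ℝ} (hf : Admissible f) :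
    ∀ᵐ x ∂unitMeas, ∀ n, ∑ m ∈ Finset.range n, coeffAt f m x ^ 2 ≤ 1 := by
  have h1 : ∀ᵐ x ∂unitMeas, sqFn f x ≤ 1 := hf.2.2
  filter_upwards [h1, ae_sqFn_eq f, ae_summable_coeffAt_sq hf.integrable hf.2.1] with x hx he hs n
  rw [he, Real.sqrt_le_one] at hx
  exact (hs.sum_le_tsum _ fun _ _ => sq_nonneg _).trans hx

lemma AdaptedTo.le_of_ae_le {n : ℕ} {G : ℝ → ℝ} (hG : AdaptedTo n G) {c : ℝ}
    (h : ∀ᵐ x ∂unitMeas, G x ≤ c) {x : ℝ} (hx : x ∈ Set.Ico (0 : ℝ) 1) : G x ≤ c := by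
  by_contra hlt
  have h1 : ∀ᵐ t ∂unitMeas, cell n (lvl n x) t = 0 := by
    filter_upwards [h] with t ht
    exact if_neg fun e => hlt (hG t x e ▸ ht)
  have h2 := integral_cell n (lvl_lt n hx.2)
  rw [integral_congr_ae h1, integral_zero] at h2
  have : (0 : ℝ) < 1 / 2 ^ n := by positivity
  linarith

lemma Admissible.sum_coeffAt_sq_le {f : ℝ → ℝ} (hf : Admissible f) (n : ℕ) {x : ℝ}
    (hx : x ∈ Set.Ico (0 : ℝ) 1) : ∑ m ∈ Finset.range n, coeffAt f m x ^ 2 ≤ 1 := by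
  refine AdaptedTo.le_of_ae_le (n := n) (G := fun x => ∑ m ∈ Finset.range n, coeffAt f m x ^ 2)
    (AdaptedTo.sum fun m hm => ?_) ?_ hx
  · exact ((adaptedTo_coeffAt f m).comp (· ^ 2)).mono (Finset.mem_range.1 hm).le
  · filter_upwards [hf.ae_sum_coeffAt_sq_le] with x hx using hx n

lemma Admissible.ae_mart_eq {f : ℝ → ℝ} (hf : Admissible f) (n : ℕ) :
    ∀ᵐ x ∂unitMeas, mart f n x = radSum (coeffAt f) n x := by
  filter_upwards [ae_mem_Ico] with x hx
  exact (radSum_coeffAt hf.integrable hf.2.1 n hx).symm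

lemma Admissible.integral_mart {f : ℝ → ℝ} (hf : Admissible f) (n : ℕ) :
    ∫ x, mart f n x ∂unitMeas = 0 :=
  (integral_congr_ae (hf.ae_mart_eq n)).trans (integral_radSum (adaptedTo_coeffAt f) n)

lemma Admissible.integral_mart_sq_le {f : ℝ → ℝ} (hf : Admissible f) (n : ℕ) :
    ∫ x, mart f n x ^ 2 ∂unitMeas ≤ 1 := by
  have h1 : ∫ x, mart f n x ^ 2 ∂unitMeas = ∫ x, radSum (coeffAt f) n x ^ 2 ∂unitMeas := by
    refine integral_congr_ae ?_
    filter_upwards [hf.ae_mart_eq n] with x hx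
    rw [hx]
  rw [h1, integral_radSum_sq (adaptedTo_coeffAt f)]
  calc ∫ x, ∑ m ∈ Finset.range n, coeffAt f m x ^ 2 ∂unitMeas ≤ ∫ _, (1 : ℝ) ∂unitMeas := by
        refine integral_mono_ae (integrable_finsetSum _ fun m _ =>
          ((adaptedTo_coeffAt f m).comp (· ^ 2)).integrable) (integrable_const _) ?_
        filter_upwards [hf.ae_sum_coeffAt_sq_le] with x hx using hx n
    _ = 1 := by simp

/-- Cantelli's inequality for the dyadic martingale. -/
lemma Admissible.measure_mart_ge_le {f : ℝ → ℝ} (hf : Admissible f) (n : ℕ) {t : ℝ} (ht : 0 < t) :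
    unitMeas.real {x | t ≤ mart f n x} ≤ 1 / (1 + t ^ 2) := by
  have hM := adaptedTo_mart f n
  have hmeas : MeasurableSet {x | t ≤ mart f n x} := measurableSet_le measurable_const hM.measurable
  have hp : (0 : ℝ) < 1 + t ^ 2 := by positivity
  have h1 : ∫ x, (t * mart f n x + 1) ^ 2 / (1 + t ^ 2) ^ 2 ∂unitMeas ≤ 1 / (1 + t ^ 2) := by
    have e : ∀ x, (t * mart f n x + 1) ^ 2 / (1 + t ^ 2) ^ 2 =
        (1 / (1 + t ^ 2) ^ 2) * (t ^ 2 * mart f n x ^ 2 + 2 * t * mart f n x + 1) := by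
      intro x; ring
    simp_rw [e]
    have i2 : Integrable (fun x => t ^ 2 * mart f n x ^ 2) unitMeas :=
      (hM.comp (· ^ 2)).integrable.const_mul _
    have i1 : Integrable (fun x => 2 * t * mart f n x) unitMeas := hM.integrable.const_mul _
    rw [integral_const_mul, integral_add (by exact i2.add i1) (integrable_const _), integral_add i2 i1,
      integral_const_mul, integral_const_mul, hf.integral_mart]
    have := hf.integral_mart_sq_le n
    simp only [mul_zero, add_zero, integral_const, probReal_univ, smul_eq_mul, mul_one]
    rw [div_mul_eq_mul_div, one_mul, div_le_div_iff₀ (by positivity) hp]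
    nlinarith [sq_nonneg t, mul_nonneg (sq_nonneg t) (sub_nonneg.2 this)]
  refine le_trans ?_ h1
  rw [← integral_indicator_one hmeas]
  refine integral_mono ((integrable_const 1).indicator hmeas)
    (hM.comp fun y => (t * y + 1) ^ 2 / (1 + t ^ 2) ^ 2).integrable fun x => ?_
  by_cases hx : t ≤ mart f n x
  · rw [Set.indicator_of_mem (show x ∈ {x | t ≤ mart f n x} from hx), Pi.one_apply,
      one_le_div (by positivity)]
    have : 1 + t ^ 2 ≤ t * mart f n x + 1 := by nlinarith
    exact pow_le_pow_left₀ hp.le this 2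
  · rw [Set.indicator_of_notMem (show x ∉ {x | t ≤ mart f n x} from hx)]
    positivity

lemma Admissible.measure_mart_lt_le {f : ℝ → ℝ} (hf : Admissible f) (n : ℕ) {M : ℝ} (hM : 0 < M) :
    unitMeas.real {x | mart f n x < -M} ≤ 1 / M ^ 2 := by
  have hA := adaptedTo_mart f n
  have hmeas : MeasurableSet {x | mart f n x < -M} :=
    measurableSet_lt hA.measurable measurable_const
  have h1 : ∫ x, 1 / M ^ 2 * mart f n x ^ 2 ∂unitMeas ≤ 1 / M ^ 2 := by
    rw [integral_const_mul]
    exact mul_le_of_le_one_right (by positivity) (hf.integral_mart_sq_le n)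
  refine le_trans ?_ h1
  rw [← integral_indicator_one hmeas]
  refine integral_mono ((integrable_const 1).indicator hmeas)
    (hA.comp fun y => 1 / M ^ 2 * y ^ 2).integrable fun x => ?_
  by_cases hx : mart f n x < -M
  · rw [Set.indicator_of_mem (show x ∈ {x | mart f n x < -M} from hx), Pi.one_apply,
      div_mul_eq_mul_div, one_mul, one_le_div (by positivity)]
    nlinarith
  · rw [Set.indicator_of_notMem (show x ∉ {x | mart f n x < -M} from hx)]
    positivity

lemma Admissible.measure_ge_le_of_mart {f : ℝ → ℝ} (hf : Admissible f) {s t c : ℝ} (hst : s < t)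
    (h : ∀ n, unitMeas.real {x | s ≤ mart f n x} ≤ c) : unitMeas.real {x | t ≤ f x} ≤ c := by
  set A : ℕ → Set ℝ := fun N => {x | ∀ n ≥ N, s ≤ mart f n x} with hA
  have hmono : Monotone A := fun N N' hN x hx n hn => hx n (le_trans hN hn)
  have hc : 0 ≤ c := measureReal_nonneg.trans (h 0)
  have h1 : unitMeas {x | t ≤ f x} ≤ unitMeas (⋃ N, A N) := by
    refine measure_mono_ae ?_
    filter_upwards [ae_tendsto_mart hf.integrable] with x hx hxt
    obtain ⟨N, hN⟩ := eventually_atTop.1 (hx.eventually (lt_mem_nhds (hst.trans_le hxt)))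
    exact Set.mem_iUnion.2 ⟨N, fun n hn => (hN n hn).le⟩
  refine ENNReal.toReal_le_of_le_ofReal hc (h1.trans ?_)
  rw [hmono.measure_iUnion]
  refine iSup_le fun N => ?_
  rw [← ofReal_measureReal]
  exact ENNReal.ofReal_le_ofReal
    ((measureReal_mono fun x (hx : x ∈ A N) => hx N le_rfl).trans (h N))

lemma AdaptedTo.integral_mul_prod {n : ℕ} {G : ℝ → ℝ} (hG : AdaptedTo n G) (N : ℕ) :
    AdaptedTo (n + N) (fun x => G x * ∏ i ∈ Finset.range N, (1 + rad (n + i) x) / 2) ∧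
    ∫ x, G x * ∏ i ∈ Finset.range N, (1 + rad (n + i) x) / 2 ∂unitMeas =
      1 / 2 ^ N * ∫ x, G x ∂unitMeas := by
  induction N with
  | zero => simpa using hG
  | succ N ih =>
    set H := fun x => G x * ∏ i ∈ Finset.range N, (1 + rad (n + i) x) / 2 with hH
    have e : ∀ x, G x * ∏ i ∈ Finset.range (N + 1), (1 + rad (n + i) x) / 2 =
        1 / 2 * (H x + H x * rad (n + N) x) := by
      intro x
      rw [Finset.prod_range_succ, hH]
      ring
    have hHr : AdaptedTo (n + N + 1) (fun x => H x * rad (n + N) x) :=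
      (ih.1.mono (Nat.le_succ _)).mul (adaptedTo_rad _)
    simp_rw [e]
    refine ⟨((ih.1.mono (Nat.le_succ _)).add hHr).comp (1 / 2 * ·), ?_⟩
    rw [integral_const_mul, integral_add ih.1.integrable hHr.integrable, ih.1.integral_mul_rad,
      ih.2, pow_succ]
    field_simp
    ring

lemma Admissible.exists_admissible_measure_ge {f : ℝ → ℝ} (hf : Admissible f) (n N : ℕ)
    {r x M : ℝ} (hr0 : 0 < r) (hr1 : r < 1) (hM : 0 < M) (hN : 0 < N)
    (hxN : (x + M) ^ 2 ≤ N * (1 - r ^ 2)) :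
    ∃ g, Admissible g ∧
      unitMeas.real {t | x ≤ r * mart f n t} +
        1 / 2 ^ N * (1 - unitMeas.real {t | x ≤ r * mart f n t} - 1 / M ^ 2) ≤
      unitMeas.real {t | x ≤ g t} := by
  have hN' : (0 : ℝ) < N := by exact_mod_cast hN
  set c : ℝ := (x + M) / N with hc
  set s : ℝ → ℝ := fun t => if r * mart f n t < x then c else 0 with hs
  set b : ℕ → ℝ → ℝ := fun m t => if m < n then r * coeffAt f m t else s t with hb
  have hA := adaptedTo_mart f n
  have hsA : AdaptedTo n s := hA.comp fun y => if r * y < x then c else 0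
  have hbA : ∀ m, AdaptedTo m (b m) := by
    intro m
    by_cases h : m < n
    · simpa only [hb, if_pos h] using (adaptedTo_coeffAt f m).comp (r * ·)
    · simpa only [hb, if_neg h] using hsA.mono (not_lt.1 h)
  have hsum : ∀ t (F : ℝ → ℕ → ℝ), ∑ m ∈ Finset.range (n + N), F (b m t) m =
      ∑ m ∈ Finset.range n, F (r * coeffAt f m t) m +
        ∑ i ∈ Finset.range N, F (s t) (n + i) := by
    intro t F
    rw [Finset.sum_range_add]
    refine congrArg₂ (· + ·) (Finset.sum_congr rfl fun m hm => ?_)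
      (Finset.sum_congr rfl fun m _ => ?_)
    · rw [hb]; simp only [if_pos (Finset.mem_range.1 hm)]
    · rw [hb]; simp only [if_neg (not_lt.2 (Nat.le_add_right n m))]
  refine ⟨radSum b (n + N), admissible_radSum hbA _ fun t ht => ?_, ?_⟩
  · rw [hsum t fun y _ => y ^ 2]
    simp only [mul_pow, ← Finset.mul_sum, Finset.sum_const, Finset.card_range, nsmul_eq_mul]
    have h1 := hf.sum_coeffAt_sq_le n ht
    have h2 : N * s t ^ 2 ≤ 1 - r ^ 2 := by
      by_cases h : r * mart f n t < x
      · simp only [hs, if_pos h, hc]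
        rw [div_pow, mul_div_assoc', div_le_iff₀ (by positivity)]
        nlinarith
      · simp only [hs, if_neg h]
        nlinarith
    nlinarith [sq_nonneg r]
  have hg : ∀ t ∈ Set.Ico (0 : ℝ) 1, radSum b (n + N) t =
      r * mart f n t + s t * ∑ i ∈ Finset.range N, rad (n + i) t := by
    intro t ht
    rw [radSum, hsum t fun y m => y * rad m t, ← radSum_coeffAt hf.integrable hf.2.1 n ht, radSum,
      Finset.mul_sum, Finset.mul_sum]
    simp only [mul_assoc]
  have hmm : Measurable fun t => r * mart f n t := hA.measurable.const_mul r
  have hm1 : MeasurableSet {t | x ≤ r * mart f n t} := measurableSet_le measurable_const hmm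
  set T : Set ℝ := {t | r * mart f n t < x ∧ -M ≤ r * mart f n t} with hT
  have hmT : MeasurableSet T :=
    (measurableSet_lt hmm measurable_const).inter (measurableSet_le measurable_const hmm)
  have hmg : MeasurableSet {t | x ≤ radSum b (n + N) t} :=
    measurableSet_le measurable_const (adaptedTo_radSum hbA _).measurable
  have hTA : AdaptedTo n (T.indicator 1) := by
    intro u v h
    have := hA u v h
    simp only [Set.indicator, hT, Set.mem_ofPred_eq, this, Pi.one_apply]
  have hTm : 1 - unitMeas.real {t | x ≤ r * mart f n t} - 1 / M ^ 2 ≤ unitMeas.real T := by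
    have hcov : (Set.univ : Set ℝ) ⊆
        ({t | x ≤ r * mart f n t} ∪ T) ∪ {t | mart f n t < -M} := by
      intro t _
      by_cases h1 : x ≤ r * mart f n t
      · exact Or.inl (Or.inl h1)
      by_cases h2 : -M ≤ r * mart f n t
      · exact Or.inl (Or.inr ⟨not_le.1 h1, h2⟩)
      · refine Or.inr (show mart f n t < -M from ?_)
        by_contra h3
        nlinarith [not_le.1 h2, not_lt.1 h3]
    have h1 := (measureReal_mono (μ := unitMeas) hcov).trans (measureReal_union_le _ _)
    have h2 := measureReal_union_le (μ := unitMeas) {t | x ≤ r * mart f n t} T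
    have h3 := hf.measure_mart_lt_le n hM
    rw [probReal_univ] at h1
    linarith
  obtain ⟨hPA, hP⟩ := hTA.integral_mul_prod N
  have hint : ∫ t, ({t | x ≤ r * mart f n t}.indicator 1 t +
      T.indicator 1 t * ∏ i ∈ Finset.range N, (1 + rad (n + i) t) / 2) ∂unitMeas =
      unitMeas.real {t | x ≤ r * mart f n t} + 1 / 2 ^ N * unitMeas.real T := by
    rw [integral_add (by exact (integrable_const (1 : ℝ)).indicator hm1) hPA.integrable, hP,
      integral_indicator_one hm1, integral_indicator_one hmT]
  calc unitMeas.real {t | x ≤ r * mart f n t} +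
        1 / 2 ^ N * (1 - unitMeas.real {t | x ≤ r * mart f n t} - 1 / M ^ 2)
      ≤ unitMeas.real {t | x ≤ r * mart f n t} + 1 / 2 ^ N * unitMeas.real T := by gcongr
    _ ≤ unitMeas.real {t | x ≤ radSum b (n + N) t} := ?_
  rw [← hint, ← integral_indicator_one hmg]
  refine integral_mono_ae (((integrable_const (1 : ℝ)).indicator hm1).add hPA.integrable)
    ((integrable_const (1 : ℝ)).indicator hmg) ?_
  filter_upwards [ae_mem_Ico] with t ht
  have hgt := hg t ht
  by_cases h1 : x ≤ r * mart f n t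
  · have hst : s t = 0 := if_neg (not_lt.2 h1)
    rw [hst, zero_mul, add_zero] at hgt
    have hgx : x ≤ radSum b (n + N) t := hgt ▸ h1
    simp [hT, h1, hgx, not_lt.2 h1]
  · have hst : s t = c := if_pos (not_le.1 h1)
    by_cases h2 : t ∈ T ∧ ∀ i ∈ Finset.range N, rad (n + i) t = 1
    · rw [hst, Finset.sum_congr rfl h2.2, Finset.sum_const, Finset.card_range, nsmul_eq_mul,
        mul_one, hc, div_mul_cancel₀ _ hN'.ne'] at hgt
      have hgx : x ≤ radSum b (n + N) t := by linarith [h2.1.2]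
      have hpr : ∏ i ∈ Finset.range N, (1 + rad (n + i) t) / 2 = 1 :=
        Finset.prod_eq_one fun i hi => by rw [h2.2 i hi]; norm_num
      simp [h1, hgx, h2.1, hpr]
    · have hz : T.indicator 1 t * ∏ i ∈ Finset.range N, (1 + rad (n + i) t) / 2 = 0 := by
        by_cases h3 : t ∈ T
        · have h4 : ∃ i ∈ Finset.range N, rad (n + i) t ≠ 1 := by
            by_contra! h5
            exact h2 ⟨h3, h5⟩
          obtain ⟨i, hi, hri⟩ := h4
          rw [Finset.prod_eq_zero hi, mul_zero]
          have : rad (n + i) t = -1 := by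
            unfold rad at hri ⊢
            split_ifs at hri ⊢ <;> simp_all
          rw [this]; norm_num
        · rw [Set.indicator_of_notMem h3, zero_mul]
      have h1' : t ∉ {t | x ≤ r * mart f n t} := h1
      rw [hz, Set.indicator_of_notMem h1', zero_add]
      exact Set.indicator_nonneg (fun _ _ => zero_le_one) _

lemma volume_setOf_ge_eq (f : ℝ → ℝ) (x : ℝ) :
    (volume {y ∈ Set.Icc (0 : ℝ) 1 | x ≤ f y}).toReal = unitMeas.real {t | x ≤ f t} := by
  rw [Measure.real, unitMeas, Measure.restrict_apply' measurableSet_Icc, Set.inter_comm]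
  rfl

lemma bddAbove_bellman (x : ℝ) : BddAbove {m : ℝ | ∃ f : ℝ → ℝ, Admissible f ∧
    m = (volume {y ∈ Set.Icc (0 : ℝ) 1 | x ≤ f y}).toReal} := by
  refine ⟨1, ?_⟩
  rintro _ ⟨f, -, rfl⟩
  rw [volume_setOf_ge_eq]
  exact measureReal_le_one

lemma le_bellman {f : ℝ → ℝ} (hf : Admissible f) (x : ℝ) :
    unitMeas.real {t | x ≤ f t} ≤ bellman x :=
  le_csSup (bddAbove_bellman x) ⟨f, hf, (volume_setOf_ge_eq f x).symm⟩

lemma admissible_zero : Admissible (fun _ => 0) :=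
  ⟨integrable_zero _ _ _, by simp, ae_of_all _ fun x => by simp [sqFn, haarCoeff]⟩

lemma bellman_le {x c : ℝ} (h : ∀ f, Admissible f → unitMeas.real {t | x ≤ f t} ≤ c) :
    bellman x ≤ c := by
  refine csSup_le ⟨_, _, admissible_zero, rfl⟩ ?_
  rintro _ ⟨f, hf, rfl⟩
  rw [volume_setOf_ge_eq]
  exact h f hf

lemma bellman_lt_one {y : ℝ} (hy : 0 < y) : bellman y < 1 := by
  have h : bellman y ≤ 1 / (1 + (y / 2) ^ 2) := bellman_le fun f hf =>
    hf.measure_ge_le_of_mart (half_lt_self hy) fun n => hf.measure_mart_ge_le n (half_pos hy)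
  refine h.trans_lt ((div_lt_one (by positivity)).2 ?_)
  have : 0 < (y / 2) ^ 2 := by positivity
  linarith

lemma bellman_lt_bellman {x y : ℝ} (hx : 0 ≤ x) (hxy : x < y) : bellman y < bellman x := by
  have hy : 0 < y := hx.trans_lt hxy
  have hp := bellman_lt_one hy
  set r : ℝ := (x + y) / (2 * y) with hr
  have hr0 : 0 < r := by positivity
  have hr1 : r < 1 := (div_lt_one (by positivity)).2 (by linarith)
  have hry : x / r < y := by
    rw [div_lt_iff₀ hr0, hr, mul_div_assoc', lt_div_iff₀ (by positivity)]
    nlinarith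
  obtain ⟨M, hM⟩ := exists_nat_gt (1 / (1 - bellman y))
  have hM0 : (0 : ℝ) < M := lt_trans (by have := sub_pos.2 hp; positivity) hM
  have hM1 : (1 : ℝ) ≤ M := by exact_mod_cast hM0
  have hMp : 1 / (M : ℝ) ^ 2 < 1 - bellman y := by
    rw [div_lt_iff₀ (sub_pos.2 hp)] at hM
    rw [div_lt_iff₀ (by positivity)]
    nlinarith [sub_pos.2 hp]
  have hr2 : 0 < 1 - r ^ 2 := by nlinarith
  obtain ⟨N, hN⟩ := exists_nat_gt ((x + M) ^ 2 / (1 - r ^ 2))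
  have hN0 : 0 < N := by
    have : (0 : ℝ) < N := lt_of_le_of_lt (by positivity) hN
    exact_mod_cast this
  have hN2 : (x + M) ^ 2 ≤ N * (1 - r ^ 2) := ((div_lt_iff₀ hr2).1 hN).le
  set d : ℝ := 1 / 2 ^ N with hd
  have hd0 : 0 < d := by positivity
  have hd1 : 0 < 1 - d := by
    rw [sub_pos, hd, div_lt_one (by positivity)]
    exact one_lt_pow₀ (by norm_num) hN0.ne'
  have hle : bellman y ≤ (bellman x - d * (1 - 1 / (M : ℝ) ^ 2)) / (1 - d) := by
    refine bellman_le fun f hf => hf.measure_ge_le_of_mart hry fun n => ?_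
    obtain ⟨g, hg, hgm⟩ := hf.exists_admissible_measure_ge n N hr0 hr1 hM0 hN0 hN2
    have h1 := hgm.trans (le_bellman hg x)
    have e : {t | x / r ≤ mart f n t} = {t | x ≤ r * mart f n t} := by
      ext t
      simp only [Set.mem_ofPred_eq, div_le_iff₀ hr0, mul_comm]
    rw [e, le_div_iff₀ hd1]
    linarith
  rw [le_div_iff₀ hd1] at hle
  nlinarith

lemma bellman_eq_one {x : ℝ} (hx : x ≤ 0) : bellman x = 1 := by
  refine le_antisymm (bellman_le fun f _ => measureReal_le_one) ?_
  have h := le_bellman admissible_zero x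
  simpa [hx] using h

theorem bellman_eq_one_and_strictAnti :
    (∀ x : ℝ, x ≤ 0 → bellman x = 1) ∧ StrictAntiOn bellman (Set.Ici 0) := by
  exact ⟨fun _ => bellman_eq_one, fun _ hx _ _ hxy => bellman_lt_bellman hx hxy⟩
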